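/- arXiv:2604.28005 — 2 statements merged into one kernel-verified Lean document; each statement's English description precedes it below -/
import Mathlib

section
/- Let s ≥ 1 and p ≥ 1 be integers. Let K : ℝ → ℝ be a kernel of order s (bounded, vanishing outside [0,1], ∫₀¹ K = 1, ∫₀¹ uʲ K(u) du = 0 for 1 ≤ j ≤ s−1) that is in addition Lipschitz on (0,1] with constant Λ and satisfies |K| ≤ κ. Let v : ℝ → ℝ be p-smooth with constant L (p-times continuously differentiable with all derivatives of order 0 through p bounded by L). Then there exists a constant C depending only on (p, s, L, Λ, κ) such that for every n ≥ 1 and every h ∈ (0,1] with n·h ≥ 1, the bias of the kernel value estimator satisfies |(1/(n·h)) · ∑_{j=0}^{n−1} K((n−j)/(n·h)) · v(j/n) − v(1)| ≤ C · (h^{min(p,s)} + 1/(n·h)). -/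
open MeasureTheory in
theorem intervalIntegrable_of_bounded_of_lipschitz {f : ℝ → ℝ} {B M : ℝ}
    (hB : ∀ u ∈ Set.Ioc (0 : ℝ) 1, |f u| ≤ B)
    (hM : ∀ x ∈ Set.Ioc (0 : ℝ) 1, ∀ y ∈ Set.Ioc (0 : ℝ) 1, |f x - f y| ≤ M * |x - y|) :
    IntervalIntegrable f volume 0 1 := by
  rw [intervalIntegrable_iff_integrableOn_Ioc_of_le zero_le_one]
  have hc : ContinuousOn f (Set.Ioc 0 1) :=
    (LipschitzOnWith.of_dist_le' (K := M) fun x hx y hy => by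
      simpa [Real.dist_eq] using hM x hx y hy).continuousOn
  refine IntegrableOn.of_bound (by simp) (hc.aestronglyMeasurable measurableSet_Ioc) B ?_
  filter_upwards [ae_restrict_mem measurableSet_Ioc] with u hu
  exact hB u hu

/-- Riemann sums with real mesh `1 / N` of a bounded function that is Lipschitz on `(0, 1]`. -/
theorem abs_riemannSum_sub_integral_le {f : ℝ → ℝ} {B M N : ℝ} (hN : 1 ≤ N)
    (hB : ∀ u ∈ Set.Ioc (0 : ℝ) 1, |f u| ≤ B)
    (hM : ∀ x ∈ Set.Ioc (0 : ℝ) 1, ∀ y ∈ Set.Ioc (0 : ℝ) 1, |f x - f y| ≤ M * |x - y|) :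
    |1 / N * ∑ k ∈ Finset.range ⌊N⌋₊, f ((k + 1 : ℕ) / N) - ∫ u in (0 : ℝ)..1, f u|
      ≤ (M + B) / N := by
  have hN0 : 0 < N := by linarith
  have hB0 : 0 ≤ B := (abs_nonneg _).trans (hB 1 (by simp))
  have hM0 : 0 ≤ M := by
    have := (abs_nonneg _).trans (hM 1 (by simp) (1 / 2) (by norm_num))
    norm_num at this
    exact this
  have hint := intervalIntegrable_of_bounded_of_lipschitz hB hM
  set m := ⌊N⌋₊ with hm
  have hmN : (m : ℝ) ≤ N := Nat.floor_le hN0.le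
  have hNm : N < m + 1 := Nat.lt_floor_add_one N
  have hmem : ∀ k ≤ m, (k : ℝ) / N ∈ Set.Icc (0 : ℝ) 1 := fun k hk =>
    ⟨by positivity, (div_le_one hN0).2 (le_trans (by exact_mod_cast hk) hmN)⟩
  have hsub : ∀ a ∈ Set.Icc (0 : ℝ) 1, ∀ b ∈ Set.Icc (0 : ℝ) 1,
      IntervalIntegrable f MeasureTheory.volume a b := fun a ha b hb =>
    hint.mono_set (by
      rw [Set.uIcc_of_le (zero_le_one' ℝ)]
      exact Set.uIcc_subset_Icc ha hb)
  have hsum : ∑ k ∈ Finset.range m, ∫ u in ((k : ℕ) : ℝ) / N..((k + 1 : ℕ) : ℝ) / N, f u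
      = ∫ u in (0 : ℝ)..(m : ℝ) / N, f u := by
    have := intervalIntegral.sum_integral_adjacent_intervals (f := f)
      (μ := MeasureTheory.volume) (a := fun k : ℕ => (k : ℝ) / N) (n := m)
      (fun k hk => hsub _ (hmem k hk.le) _ (hmem (k + 1) hk))
    simpa using this
  have hsplit : ∫ u in (0 : ℝ)..1, f u
      = (∫ u in (0 : ℝ)..(m : ℝ) / N, f u) + ∫ u in (m : ℝ) / N..1, f u :=
    (intervalIntegral.integral_add_adjacent_intervals
      (hsub _ (by simp) _ (hmem m le_rfl)) (hsub _ (hmem m le_rfl) _ (by simp))).symm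
  have htail : |∫ u in (m : ℝ) / N..1, f u| ≤ B * (1 / N) := by
    have h1 := (hmem m le_rfl).2
    have h2 : 1 - (m : ℝ) / N ≤ 1 / N := by
      rw [one_sub_div hN0.ne']
      gcongr
      linarith
    rw [← Real.norm_eq_abs]
    refine (intervalIntegral.norm_integral_le_of_norm_le_const (C := B) fun x hx => ?_).trans ?_
    · rw [Set.uIoc_of_le h1] at hx
      exact hB x ⟨(hmem m le_rfl).1.trans_lt hx.1, hx.2⟩
    · rw [abs_of_nonneg (by linarith)]
      gcongr
  have hcell : ∀ k ∈ Finset.range m,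
      |1 / N * f ((k + 1 : ℕ) / N) - ∫ u in ((k : ℕ) : ℝ) / N..((k + 1 : ℕ) : ℝ) / N, f u|
        ≤ M * (1 / N) * (1 / N) := by
    intro k hk
    have hk' : k + 1 ≤ m := Finset.mem_range.1 hk
    have hlen : ((k + 1 : ℕ) : ℝ) / N - k / N = 1 / N := by
      push_cast
      ring
    have hle : (k : ℝ) / N ≤ ((k + 1 : ℕ) : ℝ) / N := by
      gcongr
      simp
    have hpos : (0 : ℝ) < ((k + 1 : ℕ) : ℝ) / N := by positivity
    have hconst : 1 / N * f ((k + 1 : ℕ) / N)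
        = ∫ _ in ((k : ℕ) : ℝ) / N..((k + 1 : ℕ) : ℝ) / N, f ((k + 1 : ℕ) / N) := by
      rw [intervalIntegral.integral_const, hlen, smul_eq_mul]
    rw [hconst, ← intervalIntegral.integral_sub (by simp)
      (hsub _ (hmem k (by omega)) _ (hmem _ hk')),
      ← Real.norm_eq_abs]
    refine (intervalIntegral.norm_integral_le_of_norm_le_const (C := M * (1 / N))
      fun x hx => ?_).trans ?_
    · rw [Set.uIoc_of_le hle] at hx
      refine (hM _ ⟨hpos, (hmem _ hk').2⟩ x
        ⟨(hmem k (by omega)).1.trans_lt hx.1, hx.2.trans (hmem _ hk').2⟩).trans ?_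
      rw [abs_of_nonneg (by linarith [hx.2])]
      gcongr
      linarith [hx.1]
    · rw [hlen, abs_of_nonneg (by positivity)]
  have hdecomp : 1 / N * ∑ k ∈ Finset.range m, f ((k + 1 : ℕ) / N) - ∫ u in (0 : ℝ)..1, f u
      = ∑ k ∈ Finset.range m, (1 / N * f ((k + 1 : ℕ) / N)
          - ∫ u in ((k : ℕ) : ℝ) / N..((k + 1 : ℕ) : ℝ) / N, f u)
        - ∫ u in (m : ℝ) / N..1, f u := by
    rw [Finset.sum_sub_distrib, hsum, hsplit, ← Finset.mul_sum]
    ring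
  rw [hdecomp]
  calc _ ≤ ∑ _k ∈ Finset.range m, M * (1 / N) * (1 / N) + B * (1 / N) :=
        (abs_sub _ _).trans (add_le_add
          ((Finset.abs_sum_le_sum_abs _ _).trans (Finset.sum_le_sum hcell)) htail)
    _ = (m / N) * (M * (1 / N)) + B * (1 / N) := by
        rw [Finset.sum_const, Finset.card_range, nsmul_eq_mul]
        ring
    _ ≤ 1 * (M * (1 / N)) + B * (1 / N) := by
        gcongr
        exact (hmem m le_rfl).2
    _ = (M + B) / N := by ring

/-- Taylor expansion to the left of `1`, with an unspecified Taylor polynomial. -/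
theorem exists_taylor_coeff {v : ℝ → ℝ} {L : ℝ} {r : ℕ} (hv : ContDiff ℝ (r + 1 : ℕ) v)
    (hL : ∀ t, |iteratedDeriv (r + 1) v t| ≤ L) :
    ∃ c : ℕ → ℝ, c 0 = v 1 ∧ ∀ t ∈ Set.Icc (0 : ℝ) 1,
      |v (1 - t) - ∑ k ∈ Finset.range (r + 1), c k * t ^ k| ≤ L * t ^ (r + 1) := by
  have hg : ContDiff ℝ (r + 1 : ℕ) fun t => v (1 - t) := hv.comp (by fun_prop)
  have hL0 : 0 ≤ L := (abs_nonneg _).trans (hL 0)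
  refine ⟨fun k => (k.factorial : ℝ)⁻¹ *
    iteratedDerivWithin k (fun t => v (1 - t)) (Set.Icc 0 1) 0, by simp, fun t ht => ?_⟩
  have h := taylor_mean_remainder_bound (f := fun t => v (1 - t)) (C := L) (n := r)
    zero_le_one (by exact_mod_cast hg.contDiffOn) ht (fun y hy => by
      rw [iteratedDerivWithin_eq_iteratedDeriv (uniqueDiffOn_Icc_zero_one) hg.contDiffAt hy,
        iteratedDeriv_comp_const_sub]
      simpa using hL (1 - y))
  rw [taylor_within_apply, Real.norm_eq_abs, sub_zero] at h
  refine le_trans (le_of_eq ?_) (h.trans ?_)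
  · congr 2
    refine Finset.sum_congr rfl fun k _ => ?_
    rw [smul_eq_mul]
    ring
  · exact div_le_self (mul_nonneg hL0 (pow_nonneg ht.1 _))
      (by exact_mod_cast Nat.one_le_iff_ne_zero.2 (Nat.factorial_ne_zero r))

/-- Bias of smoothing by a kernel whose moments of orders `1, …, r` vanish. -/
theorem abs_integral_kernel_mul_sub_le {K v : ℝ → ℝ} {L κ h : ℝ} {r : ℕ}
    (hKint : IntervalIntegrable K MeasureTheory.volume 0 1)
    (hκ : ∀ u, |K u| ≤ κ) (hK1 : ∫ u in (0 : ℝ)..1, K u = 1)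
    (hmom : ∀ j : ℕ, 1 ≤ j → j ≤ r → ∫ u in (0 : ℝ)..1, u ^ j * K u = 0)
    (hv : ContDiff ℝ (r + 1 : ℕ) v) (hL : ∀ t, |iteratedDeriv (r + 1) v t| ≤ L)
    (hh : h ∈ Set.Ioc (0 : ℝ) 1) :
    |(∫ u in (0 : ℝ)..1, K u * v (1 - h * u)) - v 1| ≤ κ * L * h ^ (r + 1) := by
  obtain ⟨c, hc0, hc⟩ := exists_taylor_coeff hv hL
  have hκ0 : 0 ≤ κ := (abs_nonneg _).trans (hκ 0)
  have hL0 : 0 ≤ L := (abs_nonneg _).trans (hL 0)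
  have hterm : ∀ k ∈ Finset.range (r + 1), IntervalIntegrable
      (fun u => c k * h ^ k * (u ^ k * K u)) MeasureTheory.volume 0 1 := fun k _ =>
    (hKint.continuousOn_mul (by fun_prop)).const_mul _
  have hmain : IntervalIntegrable (fun u => K u * v (1 - h * u)) MeasureTheory.volume 0 1 :=
    hKint.mul_continuousOn (hv.continuous.comp (by fun_prop)).continuousOn
  have hpoly : ∫ u in (0 : ℝ)..1, ∑ k ∈ Finset.range (r + 1), c k * h ^ k * (u ^ k * K u)
      = v 1 := by
    rw [intervalIntegral.integral_finsetSum hterm, Finset.sum_range_succ',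
      Finset.sum_eq_zero fun k hk => ?_]
    · simp [hK1, hc0]
    · rw [intervalIntegral.integral_const_mul, hmom (k + 1) (by omega)
        (Finset.mem_range.1 hk), mul_zero]
  have hpint : IntervalIntegrable
      (fun u => ∑ k ∈ Finset.range (r + 1), c k * h ^ k * (u ^ k * K u))
      MeasureTheory.volume 0 1 := by
    have := IntervalIntegrable.sum _ hterm
    rwa [Finset.sum_fn] at this
  rw [← hpoly, ← intervalIntegral.integral_sub hmain hpint]
  rw [← Real.norm_eq_abs]
  refine (intervalIntegral.norm_integral_le_of_norm_le_const (C := κ * L * h ^ (r + 1))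
    fun u hu => ?_).trans_eq (by simp)
  rw [Set.uIoc_of_le zero_le_one] at hu
  have hhu : h * u ≤ h := mul_le_of_le_one_right hh.1.le hu.2
  have hhu0 : 0 ≤ h * u := mul_nonneg hh.1.le hu.1.le
  have hfactor : K u * v (1 - h * u) - ∑ k ∈ Finset.range (r + 1), c k * h ^ k * (u ^ k * K u)
      = K u * (v (1 - h * u) - ∑ k ∈ Finset.range (r + 1), c k * (h * u) ^ k) := by
    rw [mul_sub, Finset.mul_sum]
    congr 1
    refine Finset.sum_congr rfl fun k _ => ?_
    ring
  rw [hfactor, Real.norm_eq_abs, abs_mul, mul_assoc]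
  exact mul_le_mul (hκ u) ((hc _ ⟨hhu0, hhu.trans hh.2⟩).trans (by gcongr))
    (abs_nonneg _) hκ0

theorem abs_sub_le_of_abs_deriv_le {v : ℝ → ℝ} {L : ℝ} (hv : Differentiable ℝ v)
    (hL : ∀ t, |deriv v t| ≤ L) (x y : ℝ) : |v x - v y| ≤ L * |x - y| :=
  convex_univ.norm_image_sub_le_of_norm_deriv_le (fun t _ => hv t) (fun t _ => hL t)
    (Set.mem_univ y) (Set.mem_univ x)

/-- A kernel sum over past iterations, reindexed by lag and cut off at the end of the support. -/
theorem sum_kernel_eq_sum_range_floor {K v : ℝ → ℝ} {n : ℕ} {h : ℝ}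
    (hK : ∀ u, u ∉ Set.Icc (0 : ℝ) 1 → K u = 0) (hn : 1 ≤ n) (hh : h ∈ Set.Ioc (0 : ℝ) 1) :
    ∑ j ∈ Finset.range n, K (((n : ℝ) - j) / (n * h)) * v ((j : ℝ) / n)
      = ∑ k ∈ Finset.range ⌊(n : ℝ) * h⌋₊,
          K ((k + 1 : ℕ) / (n * h)) * v (1 - h * ((k + 1 : ℕ) / (n * h))) := by
  have hn0 : (0 : ℝ) < n := by exact_mod_cast hn
  have hN0 : 0 < (n : ℝ) * h := mul_pos hn0 hh.1
  have hle : ⌊(n : ℝ) * h⌋₊ ≤ n :=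
    Nat.floor_le_of_le (mul_le_of_le_one_right hn0.le hh.2)
  rw [Finset.sum_subset (Finset.range_mono hle), ← Finset.sum_range_reflect]
  · refine Finset.sum_congr rfl fun j hj => ?_
    have hcast : ((n - 1 - j : ℕ) : ℝ) = n - (j + 1 : ℕ) := by
      rw [Nat.sub_sub, add_comm 1 j, Nat.cast_sub (Finset.mem_range.1 hj)]
    have hh0 := hh.1.ne'
    rw [hcast]
    congr 2
    · ring
    · field_simp
  · intro k _ hk
    rw [hK, zero_mul]
    refine fun hmem => hk (Finset.mem_range.2 (Nat.le_floor ?_))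
    exact (div_le_one hN0).1 hmem.2


/-- **Bias of the kernel value estimator (Theorem 1, bias part).**
For every choice of integers `p, s ≥ 1` and constants `L, Λ, κ` there is a
constant `C` (depending only on `(p, s, L, Λ, κ)`) such that for every kernel
`K` of order `s` supported in `[0,1]`, bounded by `κ`, `Λ`-Lipschitz on
`(0,1]`, and every `p`-smooth function `v` with constant `L`, the bias of the
kernel value estimator is at most `C * (h ^ min p s + 1 / (n * h))`. -/
theorem kernel_value_estimator_bias (p s : ℕ) (hp : 1 ≤ p) (hs : 1 ≤ s)
    (L Λ κ : ℝ) :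
    ∃ C : ℝ, ∀ K : ℝ → ℝ, ∀ v : ℝ → ℝ,
      (∀ u, |K u| ≤ κ) →
      (∀ u, u ∉ Set.Icc (0 : ℝ) 1 → K u = 0) →
      (∫ u in (0:ℝ)..1, K u) = 1 →
      (∀ j : ℕ, 1 ≤ j → j ≤ s - 1 → ∫ u in (0:ℝ)..1, u ^ j * K u = 0) →
      (∀ u₁ ∈ Set.Ioc (0 : ℝ) 1, ∀ u₂ ∈ Set.Ioc (0 : ℝ) 1,
        |K u₁ - K u₂| ≤ Λ * |u₁ - u₂|) →
      ContDiff ℝ p v →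
      (∀ j : ℕ, j ≤ p → ∀ t : ℝ, |iteratedDeriv j v t| ≤ L) →
      ∀ n : ℕ, 1 ≤ n → ∀ h : ℝ, h ∈ Set.Ioc (0 : ℝ) 1 → 1 ≤ (n : ℝ) * h →
        |(1 / ((n : ℝ) * h)) *
            (∑ j ∈ Finset.range n, K (((n : ℝ) - (j : ℝ)) / ((n : ℝ) * h)) * v ((j : ℝ) / (n : ℝ))) -
          v 1| ≤ C * (h ^ (min p s) + 1 / ((n : ℝ) * h)) := by
  refine ⟨(Λ + 3 * κ) * L, ?_⟩
  intro K v hκ hK hK1 hmom hΛ hv hL n hn h hh hnh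
  obtain ⟨r, hr⟩ : ∃ r, min p s = r + 1 := ⟨min p s - 1, by omega⟩
  have hκ0 : 0 ≤ κ := (abs_nonneg _).trans (hκ 0)
  have hL0 : 0 ≤ L := (abs_nonneg _).trans (hL 0 (Nat.zero_le _) 0)
  have hΛ0 : 0 ≤ Λ := by
    have := (abs_nonneg _).trans (hΛ 1 (by simp) (1 / 2) (by norm_num))
    norm_num at this
    exact this
  have hv0 : ∀ t, |v t| ≤ L := fun t => by simpa using hL 0 (Nat.zero_le _) t
  have hvlip : ∀ x y, |v x - v y| ≤ L * |x - y| :=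
    abs_sub_le_of_abs_deriv_le (hv.differentiable (by exact_mod_cast (by omega : p ≠ 0)))
      fun t => by simpa [iteratedDeriv_one] using hL 1 hp t
  have hbias := abs_integral_kernel_mul_sub_le (r := r)
    (intervalIntegrable_of_bounded_of_lipschitz (fun u _ => hκ u) hΛ) hκ hK1
    (fun j hj hjr => hmom j hj (by omega))
    (hv.of_le (by exact_mod_cast (by omega : r + 1 ≤ p))) (hL (r + 1) (by omega)) hh
  have hriemann := abs_riemannSum_sub_integral_le (f := fun u => K u * v (1 - h * u))
    (B := κ * L) (M := Λ * L + κ * L) hnh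
    (fun u _ => by
      rw [abs_mul]
      exact mul_le_mul (hκ u) (hv0 _) (abs_nonneg _) hκ0)
    (fun x hx y hy => by
      have hsplit : K x * v (1 - h * x) - K y * v (1 - h * y)
          = (K x - K y) * v (1 - h * x) + K y * (v (1 - h * x) - v (1 - h * y)) := by ring
      have hvh : |v (1 - h * x) - v (1 - h * y)| ≤ L * |x - y| := by
        refine (hvlip _ _).trans (mul_le_mul_of_nonneg_left ?_ hL0)
        rw [show 1 - h * x - (1 - h * y) = -(h * (x - y)) by ring, abs_neg, abs_mul,
          abs_of_pos hh.1]
        exact mul_le_of_le_one_left (abs_nonneg _) hh.2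
      rw [hsplit]
      refine (abs_add_le _ _).trans ?_
      rw [abs_mul, abs_mul]
      have h1 := mul_le_mul (hΛ x hx y hy) (hv0 (1 - h * x)) (abs_nonneg _) (by positivity)
      have h2 := mul_le_mul (hκ y) hvh (abs_nonneg _) hκ0
      linarith)
  rw [sum_kernel_eq_sum_range_floor hK hn hh, hr]
  have hpow : 0 ≤ h ^ (r + 1) := pow_nonneg hh.1.le _
  have hinv : 0 ≤ 1 / ((n : ℝ) * h) := by positivity
  calc _ ≤ (Λ * L + κ * L + κ * L) / (n * h) + κ * L * h ^ (r + 1) :=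
        (abs_sub_le _ _ _).trans (add_le_add hriemann hbias)
    _ = (Λ * L + 2 * (κ * L)) * (1 / (n * h)) + κ * L * h ^ (r + 1) := by ring
    _ ≤ (Λ + 3 * κ) * L * (1 / (n * h)) + (Λ + 3 * κ) * L * h ^ (r + 1) := by
        gcongr
        · nlinarith [mul_nonneg hκ0 hL0]
        · linarith
    _ = (Λ + 3 * κ) * L * (h ^ (r + 1) + 1 / (n * h)) := by ring
end

section
/- Let X and Y be nonempty finite types, d a natural number, p : X → ℝ a probability mass function, q : X → Y → ℝ with q x y ≥ 0 and ∑_y q x y = 1 for every x, r : X → Y → ℝ, and S : X → Y → (EuclideanSpace ℝ (Fin d)) satisfying (i) ∑_y q x y • S x y = 0 for every x and (ii) ∑_y q x y · r x y · ‖S x y‖² = (∑_y q x y · r x y) · (∑_y q x y · ‖S x y‖²) for every x. Define V x = ∑_y q x y · r x y and g = ∑_{x,y} p x · q x y · r x y • S x y. Let (Ω, F, ℙ) be a probability space carrying random variables ξ : Ω → X, υ : Ω → Y with joint law ℙ(ξ = x, υ = y) = p x · q x y, and a random baseline W : Ω → (X → ℝ) that is independent of the pair (ξ, υ) and satisfies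 𝔼[(W x)²] < ∞ for every x ∈ X. Then the mean squared error of the gradient estimator built from the estimated baseline W decomposes as: 𝔼[‖(r ξ υ − W ξ) • S ξ υ − g‖²] = 𝔼[‖(r ξ υ − V ξ) • S ξ υ − g‖²] + 𝔼[(W ξ − V ξ)² · ‖S ξ υ‖²]. -/
open MeasureTheory ProbabilityTheory

/-- The expectation of a function of a finitely valued random variable and an independent one
is the average, over the values of the former, of the expectations in the latter. -/
theorem integral_eq_sum_of_indepFun {A B Ω : Type*} [Fintype A]
    [MeasurableSpace A] [MeasurableSingletonClass A] [MeasurableSpace B] [MeasurableSpace Ω]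
    {P : Measure Ω} [IsFiniteMeasure P] {Z : Ω → A} {W : Ω → B}
    (hZ : Measurable Z) (hind : IndepFun Z W P) (f : A → B → ℝ) (hf : ∀ a, Measurable (f a))
    (hint : ∀ a, Integrable (fun ω => f a (W ω)) P) :
    ∫ ω, f (Z ω) (W ω) ∂P = ∑ a, P.real (Z ⁻¹' {a}) * ∫ ω, f a (W ω) ∂P := by
  classical
  have hone (a : A) : Measurable (({a} : Set A).indicator (1 : A → ℝ)) :=
    measurable_one.indicator (measurableSet_singleton a)
  have hcomp (a : A) : (fun ω => ({a} : Set A).indicator (1 : A → ℝ) (Z ω)) =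
      (Z ⁻¹' {a}).indicator 1 := by
    ext ω
    simp [Set.indicator]
  have hindep (a : A) : IndepFun (fun ω => ({a} : Set A).indicator (1 : A → ℝ) (Z ω))
      (fun ω => f a (W ω)) P := hind.comp (hone a) (hf a)
  have hset (a : A) : MeasurableSet (Z ⁻¹' {a}) := hZ (measurableSet_singleton a)
  have honeInt (a : A) :
      Integrable (fun ω => ({a} : Set A).indicator (1 : A → ℝ) (Z ω)) P := by
    rw [hcomp]
    exact (integrable_const (1 : ℝ)).indicator (hset a)
  calc ∫ ω, f (Z ω) (W ω) ∂P
      = ∫ ω, ∑ a, ({a} : Set A).indicator (1 : A → ℝ) (Z ω) * f a (W ω) ∂P := by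
        congr with ω
        simp [Set.indicator_apply]
    _ = ∑ a, ∫ ω, ({a} : Set A).indicator (1 : A → ℝ) (Z ω) * f a (W ω) ∂P :=
        integral_finsetSum _ fun a _ => (hindep a).integrable_mul (honeInt a) (hint a)
    _ = ∑ a, P.real (Z ⁻¹' {a}) * ∫ ω, f a (W ω) ∂P := by
        refine Finset.sum_congr rfl fun a _ => ?_
        rw [(hindep a).integral_fun_mul_eq_mul_integral (honeInt a).aestronglyMeasurable
          (hint a).aestronglyMeasurable, hcomp, integral_indicator_one (hset a)]

/-- Expansion of the squared error of a gradient estimate around a different baseline. -/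
theorem norm_sub_smul_sub_sq {E : Type*} [NormedAddCommGroup E] [InnerProductSpace ℝ E]
    (r w v : ℝ) (s g : E) :
    ‖(r - w) • s - g‖ ^ 2 = ‖(r - v) • s - g‖ ^ 2 + (w - v) ^ 2 * ‖s‖ ^ 2
      - 2 * (w - v) * ((r - v) * ‖s‖ ^ 2 - inner ℝ s g) := by
  simp only [norm_sub_sq_real, norm_smul, mul_pow, Real.norm_eq_abs, sq_abs, real_inner_smul_left]
  ring

/-- **MSE decomposition with an independent estimated baseline (Theorem 2).**
If the prompt–completion pair `(ξ, υ)` has joint pmf `p x * q x y`, the score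
has zero conditional mean, the reward is conditionally uncorrelated with the
squared norm of the score, and the random baseline `W` is independent of
`(ξ, υ)` with finite second moments, then the MSE of the gradient estimator
built from `W` equals the oracle MSE plus the expected weighted squared
baseline error. -/
theorem mse_decomposition_random_baseline {X : Type*} {Y : Type*}
    [Fintype X] [Nonempty X] [Fintype Y] [Nonempty Y]
    [MeasurableSpace X] [MeasurableSingletonClass X]
    [MeasurableSpace Y] [MeasurableSingletonClass Y] (d : ℕ)
    (p : X → ℝ) (hp : ∀ x, 0 ≤ p x) (hpsum : ∑ x, p x = 1)
    (q : X → Y → ℝ) (hq : ∀ x y, 0 ≤ q x y) (hqsum : ∀ x, ∑ y, q x y = 1)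
    (r : X → Y → ℝ) (S : X → Y → EuclideanSpace ℝ (Fin d))
    (hzero : ∀ x, ∑ y, q x y • S x y = 0)
    (huncorr : ∀ x, ∑ y, q x y * r x y * ‖S x y‖ ^ 2 =
      (∑ y, q x y * r x y) * (∑ y, q x y * ‖S x y‖ ^ 2))
    (V : X → ℝ) (hV : ∀ x, V x = ∑ y, q x y * r x y)
    (g : EuclideanSpace ℝ (Fin d))
    (hg : g = ∑ x, ∑ y, (p x * q x y * r x y) • S x y)
    {Ω : Type*} [MeasurableSpace Ω] (P : Measure Ω) [IsProbabilityMeasure P]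
    (ξ : Ω → X) (υ : Ω → Y) (W : Ω → X → ℝ)
    (hξ : Measurable ξ) (hυ : Measurable υ) (hW : Measurable W)
    (hlaw : ∀ x y, P {ω | ξ ω = x ∧ υ ω = y} = ENNReal.ofReal (p x * q x y))
    (hindep : IndepFun (fun ω => (ξ ω, υ ω)) W P)
    (hWL2 : ∀ x, Integrable (fun ω => (W ω x) ^ 2) P) :
    ∫ ω, ‖(r (ξ ω) (υ ω) - W ω (ξ ω)) • S (ξ ω) (υ ω) - g‖ ^ 2 ∂P =
      (∫ ω, ‖(r (ξ ω) (υ ω) - V (ξ ω)) • S (ξ ω) (υ ω) - g‖ ^ 2 ∂P) +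
        ∫ ω, (W ω (ξ ω) - V (ξ ω)) ^ 2 * ‖S (ξ ω) (υ ω)‖ ^ 2 ∂P := by
  have hreal (a : X × Y) :
      P.real ((fun ω => (ξ ω, υ ω)) ⁻¹' {a}) = p a.1 * q a.1 a.2 := by
    have hset : (fun ω => (ξ ω, υ ω)) ⁻¹' {a} = {ω | ξ ω = a.1 ∧ υ ω = a.2} := by
      ext ω
      simp [Prod.ext_iff]
    rw [hset, Measure.real, hlaw, ENNReal.toReal_ofReal (mul_nonneg (hp _) (hq _ _))]
  have hexp (f : X × Y → (X → ℝ) → ℝ) (hf : ∀ a, Measurable (f a))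
      (hint : ∀ a, Integrable (fun ω => f a (W ω)) P) :
      ∫ ω, f (ξ ω, υ ω) (W ω) ∂P = ∑ x, ∑ y, p x * q x y * ∫ ω, f (x, y) (W ω) ∂P := by
    rw [integral_eq_sum_of_indepFun (hξ.prodMk hυ) hindep f hf hint, Fintype.sum_prod_type]
    simp only [hreal]
  have hL2 (x : X) : MemLp (fun ω => W ω x - V x) 2 P :=
    ((memLp_two_iff_integrable_sq (measurable_pi_iff.1 hW x).aestronglyMeasurable).2
      (hWL2 x)).sub (memLp_const _)
  have hsq (x : X) : Integrable (fun ω => (W ω x - V x) ^ 2) P := (hL2 x).integrable_sq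
  have hL1 (x : X) : Integrable (fun ω => W ω x - V x) P := (hL2 x).integrable one_le_two
  have hcross (x : X) :
      ∑ y, q x y * ((r x y - V x) * ‖S x y‖ ^ 2 - inner ℝ (S x y) g) = 0 := by
    have hinner : ∑ y, q x y * inner ℝ (S x y) g = 0 := by
      simpa [sum_inner, real_inner_smul_left] using congrArg (fun v => inner ℝ v g) (hzero x)
    calc ∑ y, q x y * ((r x y - V x) * ‖S x y‖ ^ 2 - inner ℝ (S x y) g)
        = ∑ y, q x y * r x y * ‖S x y‖ ^ 2 - V x * ∑ y, q x y * ‖S x y‖ ^ 2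
          - ∑ y, q x y * inner ℝ (S x y) g := by
          rw [Finset.mul_sum, ← Finset.sum_sub_distrib, ← Finset.sum_sub_distrib]
          exact Finset.sum_congr rfl fun y _ => by ring
      _ = 0 := by rw [huncorr, hV, hinner]; ring
  have hfeas (x : X) (y : Y) (ω : Ω) := norm_sub_smul_sub_sq (r x y) (W ω x) (V x) (S x y) g
  have hlinInt (x : X) (y : Y) : Integrable (fun ω => 2 * (W ω x - V x) *
      ((r x y - V x) * ‖S x y‖ ^ 2 - inner ℝ (S x y) g)) P :=
    ((hL1 x).const_mul 2).mul_const _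
  have hsumInt (x : X) (y : Y) : Integrable (fun ω => ‖(r x y - V x) • S x y - g‖ ^ 2 +
      (W ω x - V x) ^ 2 * ‖S x y‖ ^ 2) P :=
    (integrable_const _).add ((hsq x).mul_const _)
  rw [hexp (fun a w => ‖(r a.1 a.2 - w a.1) • S a.1 a.2 - g‖ ^ 2) (fun a => by fun_prop)
      (fun a => by simpa only [hfeas] using! (hsumInt a.1 a.2).sub (hlinInt a.1 a.2)),
    hexp (fun a _ => ‖(r a.1 a.2 - V a.1) • S a.1 a.2 - g‖ ^ 2) (fun a => by fun_prop)
      (fun a => integrable_const _),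
    hexp (fun a w => (w a.1 - V a.1) ^ 2 * ‖S a.1 a.2‖ ^ 2) (fun a => by fun_prop)
      (fun a => (hsq a.1).mul_const _), ← Finset.sum_add_distrib]
  refine Finset.sum_congr rfl fun x _ => ?_
  have hmean (y : Y) : ∫ ω, ‖(r x y - W ω x) • S x y - g‖ ^ 2 ∂P =
      ∫ _, ‖(r x y - V x) • S x y - g‖ ^ 2 ∂P + ∫ ω, (W ω x - V x) ^ 2 * ‖S x y‖ ^ 2 ∂P
        - 2 * (∫ ω, (W ω x - V x) ∂P) *
          ((r x y - V x) * ‖S x y‖ ^ 2 - inner ℝ (S x y) g) := by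
    simp_rw [hfeas]
    rw [integral_sub (hsumInt x y) (hlinInt x y),
      integral_add (integrable_const _) ((hsq x).mul_const _), integral_mul_const (_ - _),
      integral_const_mul]
  simp only [hmean]
  rw [← Finset.sum_add_distrib, ← sub_eq_zero, ← Finset.sum_sub_distrib]
  calc _ = ∑ y, (-2 * p x * ∫ ω, (W ω x - V x) ∂P) *
        (q x y * ((r x y - V x) * ‖S x y‖ ^ 2 - inner ℝ (S x y) g)) :=
        Finset.sum_congr rfl fun y _ => by ring
    _ = 0 := by rw [← Finset.mul_sum, hcross, mul_zero]
end
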